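/- arXiv:1805.03864 — 2 statements merged into one kernel-verified Lean document; each statement's English description precedes it below -/
import Mathlib

section
/- Parametrization of Schubert cells in GL_n (Proposition 3.1 specialized to GL_n): fix w ∈ S_n and a reduced word w = s_{i_1}⋯s_{i_ℓ} in the adjacent transpositions. Then the map F^ℓ → G/B sending (c_1, …, c_ℓ) to the coset x_{i_1}(c_1) n_{i_1}^{-1} ⋯ x_{i_ℓ}(c_ℓ) n_{i_ℓ}^{-1} B is injective, and its image is exactly the set of cosets {gB : g ∈ BwB}. -/
open Matrix

variable (F : Type*) [Field F] (n : ℕ)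

/-- The Borel subgroup `B` of invertible upper-triangular matrices in `GL_n(F)`. -/
def Bsub : Subgroup (GL (Fin n) F) where
  carrier := {g | BlockTriangular (g : Matrix (Fin n) (Fin n) F) (id : Fin n → Fin n)}
  one_mem' := blockTriangular_one
  mul_mem' := fun ha hb => ha.mul hb
  inv_mem' := by
    intro g hg
    have : Invertible (g : Matrix (Fin n) (Fin n) F) := g.invertible
    have h := blockTriangular_inv_of_blockTriangular (M := (g : Matrix (Fin n) (Fin n) F)) hg
    simpa [coe_units_inv] using h

/-- The permutation matrix of `w`, with a `1` in position `(w k, k)` for each `k`,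
as an element of `GL_n(F)`. -/
def permGL (w : Equiv.Perm (Fin n)) : GL (Fin n) F :=
  { val := (w⁻¹).permMatrix F
    inv := w.permMatrix F
    val_inv := by
      rw [Equiv.Perm.permMatrix, Equiv.Perm.permMatrix, ← PEquiv.toMatrix_trans,
        ← Equiv.toPEquiv_trans,
        show Equiv.trans w⁻¹ w = Equiv.refl (Fin n) from Equiv.symm_trans_self w,
        Equiv.toPEquiv_refl, PEquiv.toMatrix_refl]
    inv_val := by
      rw [Equiv.Perm.permMatrix, Equiv.Perm.permMatrix, ← PEquiv.toMatrix_trans,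
        ← Equiv.toPEquiv_trans,
        show Equiv.trans w w⁻¹ = Equiv.refl (Fin n) from Equiv.self_trans_symm w,
        Equiv.toPEquiv_refl, PEquiv.toMatrix_refl] }

/-- The double coset `B w B ⊆ GL_n(F)`. -/
def doubleCoset (w : Equiv.Perm (Fin n)) : Set (GL (Fin n) F) :=
  {g | ∃ b₁ ∈ Bsub F n, ∃ b₂ ∈ Bsub F n, g = b₁ * permGL F n w * b₂}

/-- The elementary unipotent matrix `I + c E_{a b}` (for `a ≠ b`) as an element of `GL_n(F)`. -/
def elemGL (a b : Fin n) (hab : a ≠ b) (c : F) : GL (Fin n) F :=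
  { val := transvection a b c
    inv := transvection a b (-c)
    val_inv := by
      rw [transvection_mul_transvection_same _ _ hab, add_neg_cancel, transvection_zero]
    inv_val := by
      rw [transvection_mul_transvection_same _ _ hab, neg_add_cancel, transvection_zero] }

/-- `x_k(c) = I + c E_{k,k+1}` (rows/columns of `Fin n` being numbered `1, …, n`),
for `1 ≤ k ≤ n-1`; junk value `1` for out-of-range `k`. -/
def xGL (k : ℕ) (c : F) : GL (Fin n) F :=
  if h : 0 < k ∧ k < n then
    elemGL F n ⟨k - 1, by omega⟩ ⟨k, h.2⟩ (by simp [Fin.ext_iff]; omega) c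
  else 1

/-- `y_k(c) = I + c E_{k+1,k}`, for `1 ≤ k ≤ n-1`; junk value `1` for out-of-range `k`. -/
def yGL (k : ℕ) (c : F) : GL (Fin n) F :=
  if h : 0 < k ∧ k < n then
    elemGL F n ⟨k, h.2⟩ ⟨k - 1, by omega⟩ (by simp [Fin.ext_iff]; omega) c
  else 1

/-- `n_k = (I + E_{k,k+1})(I − E_{k+1,k})(I + E_{k,k+1})`. -/
def nGL (k : ℕ) : GL (Fin n) F := xGL F n k 1 * yGL F n k (-1) * xGL F n k 1

/-- The adjacent transposition `s_k = (k, k+1)` (with `1, …, n` numbering),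
for `1 ≤ k ≤ n-1`; junk value `1` for out-of-range `k`. -/
def sT (k : ℕ) : Equiv.Perm (Fin n) :=
  if h : 0 < k ∧ k < n then Equiv.swap ⟨k - 1, by omega⟩ ⟨k, h.2⟩ else 1

/-- The length `ℓ(w)` of a permutation: its number of inversions. -/
def invCount (w : Equiv.Perm (Fin n)) : ℕ :=
  (Finset.univ.filter fun p : Fin n × Fin n => p.1 < p.2 ∧ w p.2 < w p.1).card

/-- `l` is a reduced word for `w`: a minimal-length expression of `w` as a product of
adjacent transpositions. -/
def IsReducedWord (l : List ℕ) (w : Equiv.Perm (Fin n)) : Prop :=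
  (∀ k ∈ l, 0 < k ∧ k < n) ∧ (l.map (sT n)).prod = w ∧
    ∀ l' : List ℕ, (∀ k ∈ l', 0 < k ∧ k < n) → (l'.map (sT n)).prod = w →
      l.length ≤ l'.length

/-- The product `x_{i₁}(c₁) n_{i₁}⁻¹ ⋯ x_{i_ℓ}(c_ℓ) n_{i_ℓ}⁻¹` attached to a word
`l = [i₁, …, i_ℓ]` and parameters `c : Fin l.length → F`. -/
def prodWord (l : List ℕ) (c : Fin l.length → F) : GL (Fin n) F :=
  (List.ofFn fun m : Fin l.length => xGL F n (l.get m) (c m) * (nGL F n (l.get m))⁻¹).prod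

/-- The standard maximal parabolic subgroup `P_j ≤ GL_n(F)` (for `1 ≤ j ≤ n-1`):
the stabilizer of `span(e_1, …, e_j)`, i.e. the invertible block upper-triangular matrices
with diagonal blocks of sizes `j` and `n - j`. -/
def Pmax (j : ℕ) : Subgroup (GL (Fin n) F) where
  carrier := {g | BlockTriangular (g : Matrix (Fin n) (Fin n) F)
    (fun a : Fin n => if (a : ℕ) < j then (0 : ℕ) else 1)}
  one_mem' := blockTriangular_one
  mul_mem' := fun ha hb => ha.mul hb
  inv_mem' := by
    intro g hg
    have : Invertible (g : Matrix (Fin n) (Fin n) F) := g.invertible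
    have h := blockTriangular_inv_of_blockTriangular (M := (g : Matrix (Fin n) (Fin n) F)) hg
    simpa [coe_units_inv] using h

/-- `W_j = {w ∈ S_n : w({1,…,j}) = {1,…,j}}`. -/
def Wfix (j : ℕ) : Set (Equiv.Perm (Fin n)) :=
  {w | (fun a => w a) '' {a : Fin n | (a : ℕ) < j} = {a : Fin n | (a : ℕ) < j}}

/-- `W^j`: the set of permutations of minimal length (fewest inversions) in their left coset
`u W_j`. -/
def minReps (j : ℕ) : Set (Equiv.Perm (Fin n)) :=
  {u | ∀ y ∈ Wfix n j, invCount n u ≤ invCount n (u * y)}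

/-- `(W_j)^{i,j}`: the set of elements of `W_j` of minimal length in their left coset
`z W_{i,j}` inside `W_j`, where `W_{i,j} = W_i ∩ W_j`. -/
def minRepsIn (i j : ℕ) : Set (Equiv.Perm (Fin n)) :=
  {z | z ∈ Wfix n j ∧ ∀ v ∈ Wfix n i ∩ Wfix n j, invCount n z ≤ invCount n (z * v)}

lemma Bsub_mem (g : GL (Fin n) F) : g ∈ Bsub F n ↔ ∀ i j : Fin n, j < i → g.val i j = 0 :=
  ⟨fun h i j hij => h hij, fun h i j hij => h i j hij⟩

lemma Bsub_diag (g : GL (Fin n) F) (hg : g ∈ Bsub F n) (i : Fin n) : g.val i i ≠ 0 := by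
  have hd : g.val.det ≠ 0 := by
    have := (Matrix.isUnit_iff_isUnit_det g.val).1 g.isUnit
    exact this.ne_zero
  rw [Matrix.det_of_isUpperTriangular hg] at hd
  exact (Finset.prod_ne_zero_iff.1 hd) i (Finset.mem_univ i)

lemma permGL_val (w : Equiv.Perm (Fin n)) (i j : Fin n) :
    (permGL F n w).val i j = if i = w j then 1 else 0 := by
  simp only [permGL, Equiv.Perm.permMatrix, PEquiv.toMatrix_apply, Equiv.toPEquiv_apply]
  have : (w⁻¹ i = j) ↔ (i = w j) := Equiv.Perm.inv_eq_iff_eq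
  simp only [Option.mem_some_iff, eq_comm (b := w⁻¹ i), this, Option.mem_def, Option.some_inj]

lemma mul_permGL (w : Equiv.Perm (Fin n)) (g : GL (Fin n) F) (i j : Fin n) :
    (g * permGL F n w).val i j = g.val i (w j) := by
  simp [Units.val_mul, Matrix.mul_apply, permGL_val]

lemma permGL_mul (w : Equiv.Perm (Fin n)) (g : GL (Fin n) F) (i j : Fin n) :
    (permGL F n w * g).val (w i) j = g.val i j := by
  simp [Units.val_mul, Matrix.mul_apply, permGL_val]

lemma permGL_mul_mul (u w : Equiv.Perm (Fin n)) :
    permGL F n (u * w) = permGL F n u * permGL F n w := by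
  ext i j
  rw [mul_permGL, permGL_val, permGL_val, Equiv.Perm.mul_apply]

lemma permGL_one : permGL F n 1 = 1 := by
  ext i j
  rw [permGL_val, Units.val_one, Matrix.one_apply]; rfl

lemma permGL_inv (u : Equiv.Perm (Fin n)) :
    (permGL F n u)⁻¹ = permGL F n u⁻¹ := by
  rw [inv_eq_iff_mul_eq_one, ← permGL_mul_mul, mul_inv_cancel, permGL_one]

lemma conj_permGL (w : Equiv.Perm (Fin n)) (g : GL (Fin n) F) (i j : Fin n) :
    ((permGL F n w)⁻¹ * g * permGL F n w).val i j = g.val (w i) (w j) := by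
  rw [mul_permGL, ← permGL_mul F n w, mul_inv_cancel_left]

/-- hypothesis package: `a = k-1`, `b = k`. -/
structure Adj (k : ℕ) (a b : Fin n) : Prop where
  hk : 0 < k ∧ k < n
  ha : a.val + 1 = k
  hb : b.val = k

lemma Adj.exists {k : ℕ} (hk : 0 < k ∧ k < n) : ∃ a b, Adj n k a b :=
  ⟨⟨k - 1, by omega⟩, ⟨k, hk.2⟩, hk, by simp; omega, rfl⟩

variable {n} {k : ℕ} {a b : Fin n}

lemma Adj.eqs (h : Adj n k a b) :
    (⟨k - 1, by have := h.hk; omega⟩ : Fin n) = a ∧ (⟨k, h.hk.2⟩ : Fin n) = b := by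
  have := h.ha; have := h.hb
  constructor <;> ext <;> simp <;> omega

lemma Adj.lt (h : Adj n k a b) : a < b := by
  have := h.ha; have := h.hb
  rw [Fin.lt_def]; omega

lemma sT_eq (h : Adj n k a b) : sT n k = Equiv.swap a b := by
  rw [sT, dif_pos h.hk, h.eqs.1, h.eqs.2]

lemma xGL_val (h : Adj n k a b) (c : F) : (xGL F n k c).val = transvection a b c := by
  rw [xGL, dif_pos h.hk]
  simp only [elemGL, h.eqs.1, h.eqs.2]

lemma yGL_val (h : Adj n k a b) (c : F) : (yGL F n k c).val = transvection b a c := by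
  rw [yGL, dif_pos h.hk]
  simp only [elemGL, h.eqs.1, h.eqs.2]

lemma transv_mul (a b : Fin n) (c : F) (M : Matrix (Fin n) (Fin n) F) (i j : Fin n) :
    (transvection a b c * M) i j = M i j + if i = a then c * M b j else 0 := by
  by_cases h : i = a
  · subst h; simp
  · simp [h]

lemma mul_transv (a b : Fin n) (c : F) (M : Matrix (Fin n) (Fin n) F) (i j : Fin n) :
    (M * transvection a b c) i j = M i j + if j = b then c * M i a else 0 := by
  by_cases h : j = b
  · subst h; simp
  · simp [h]

lemma transv_apply (a b : Fin n) (c : F) (i j : Fin n) :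
    (transvection a b c) i j = (if i = j then 1 else 0) + if i = a ∧ j = b then c else 0 := by
  simp [transvection, Matrix.single_apply, Matrix.one_apply, eq_comm]

lemma nGL_val (h : Adj n k a b) (i j : Fin n) : (nGL F n k).val i j =
    if i = a then (if j = b then 1 else 0) else
      if i = b then (if j = a then -1 else 0) else if i = j then 1 else 0 := by
  have hab := h.lt.ne
  simp only [nGL, Units.val_mul, xGL_val F h, yGL_val F h, mul_transv, transv_apply]
  by_cases h1 : i = a <;> by_cases h2 : i = b <;> by_cases h3 : j = a <;> by_cases h4 : j = b <;>
    by_cases h5 : i = j <;> simp_all [eq_comm]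

lemma xGL_mem (h : Adj n k a b) (c : F) : xGL F n k c ∈ Bsub F n := by
  rw [Bsub_mem]
  intro i j hij
  rw [xGL_val F h, transv_apply, if_neg hij.ne', if_neg, add_zero]
  rintro ⟨rfl, rfl⟩
  exact absurd h.lt hij.not_gt

lemma xGL_inv (h : Adj n k a b) (c : F) : (xGL F n k c)⁻¹ = xGL F n k (-c) := by
  rw [inv_eq_iff_mul_eq_one]
  ext i j
  rw [Units.val_mul, xGL_val F h, xGL_val F h,
    transvection_mul_transvection_same _ _ h.lt.ne, add_neg_cancel, transvection_zero]
  rfl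

lemma xGL_mul (h : Adj n k a b) (c d : F) : xGL F n k c * xGL F n k d = xGL F n k (c + d) := by
  ext i j
  rw [Units.val_mul, xGL_val F h, xGL_val F h, xGL_val F h,
    transvection_mul_transvection_same _ _ h.lt.ne]

lemma n_mul_x (h : Adj n k a b) (d : F) :
    nGL F n k * xGL F n k d = yGL F n k (-d) * nGL F n k := by
  have hab := h.lt.ne
  ext i j
  rw [Units.val_mul, Units.val_mul, xGL_val F h, yGL_val F h, mul_transv, transv_mul]
  simp only [nGL_val F h]
  by_cases h1 : i = a <;> by_cases h2 : i = b <;> by_cases h3 : j = a <;> by_cases h4 : j = b <;>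
    by_cases h5 : i = j <;> simp_all [eq_comm]

lemma swap_lt (h : Adj n k a b) {i j : Fin n} (hij : j < i) (hne : ¬ (i = b ∧ j = a)) :
    Equiv.swap a b j < Equiv.swap a b i := by
  have h1 := h.ha
  have h2 := h.hb
  simp only [Equiv.swap_apply_def]
  simp only [Fin.ext_iff, Fin.lt_def] at *
  split_ifs <;> omega

lemma n_mul_s (h : Adj n k a b) : nGL F n k * permGL F n (sT n k) ∈ Bsub F n := by
  rw [Bsub_mem]
  intro i j hij
  have hab := h.lt
  rw [mul_permGL, nGL_val F h, sT_eq h, Equiv.swap_apply_def]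
  split_ifs <;> simp_all <;> omega

lemma sT_inv (h : Adj n k a b) : (sT n k)⁻¹ = sT n k := by
  rw [sT_eq h, Equiv.swap_inv]

lemma sT_mul (h : Adj n k a b) : sT n k * sT n k = 1 := by
  rw [sT_eq h, Equiv.swap_mul_self]

lemma s_mul_n (h : Adj n k a b) : permGL F n (sT n k) * nGL F n k ∈ Bsub F n := by
  rw [Bsub_mem]
  intro i j hij
  have hab := h.lt
  have : i = sT n k (sT n k i) := by rw [← Equiv.Perm.mul_apply, sT_mul h]; rfl
  rw [this, permGL_mul, nGL_val F h, sT_eq h, Equiv.swap_apply_def]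
  clear this
  split_ifs <;> simp_all <;> omega

/-- conjugation by s. -/
lemma conj_s (h : Adj n k a b) (g : GL (Fin n) F) (hg : g ∈ Bsub F n) (h0 : g.val a b = 0) :
    (permGL F n (sT n k)) * g * permGL F n (sT n k) ∈ Bsub F n := by
  rw [Bsub_mem] at hg ⊢
  intro i j hij
  have : permGL F n (sT n k) = (permGL F n (sT n k))⁻¹ := by rw [permGL_inv, sT_inv h]
  nth_rewrite 1 [this]
  rw [conj_permGL, sT_eq h]
  by_cases hc : i = b ∧ j = a
  · rw [hc.1, hc.2]; simpa using h0
  · exact hg _ _ (swap_lt h hij hc)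

lemma decomp_left (h : Adj n k a b) (g : GL (Fin n) F) (hg : g ∈ Bsub F n) :
    ∃ d : F, ∃ g' ∈ Bsub F n, g'.val a b = 0 ∧ g = xGL F n k d * g' := by
  refine ⟨g.val a b / g.val b b, (xGL F n k (g.val a b / g.val b b))⁻¹ * g,
    (Bsub F n).mul_mem ((Bsub F n).inv_mem (xGL_mem F h _)) hg, ?_, by group⟩
  rw [xGL_inv F h, Units.val_mul, xGL_val F h, transv_mul, if_pos rfl]
  have := Bsub_diag F n g hg b
  field_simp
  ring

lemma decomp_right (h : Adj n k a b) (g : GL (Fin n) F) (hg : g ∈ Bsub F n) :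
    ∃ d : F, ∃ g' ∈ Bsub F n, g'.val a b = 0 ∧ g = g' * xGL F n k d := by
  refine ⟨g.val a b / g.val a a, g * (xGL F n k (g.val a b / g.val a a))⁻¹,
    (Bsub F n).mul_mem hg ((Bsub F n).inv_mem (xGL_mem F h _)), ?_, by group⟩
  rw [xGL_inv F h, Units.val_mul, xGL_val F h, mul_transv, if_pos rfl]
  have := Bsub_diag F n g hg a
  field_simp
  ring

lemma conj_x (h : Adj n k a b) (w : Equiv.Perm (Fin n)) (hw : w⁻¹ a < w⁻¹ b) (d : F) :
    (permGL F n w)⁻¹ * xGL F n k d * permGL F n w ∈ Bsub F n := by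
  rw [Bsub_mem]
  intro i j hij
  rw [conj_permGL, xGL_val F h, transv_apply, if_neg (by simpa using hij.ne'), if_neg, add_zero]
  rintro ⟨rfl, rfl⟩
  simp at hw
  exact absurd hw hij.not_gt

lemma cell_sup (h : Adj n k a b) (w : Equiv.Perm (Fin n)) (hw : w⁻¹ a < w⁻¹ b) (c : F)
    (g : GL (Fin n) F) (hg : g ∈ doubleCoset F n w) :
    xGL F n k c * (nGL F n k)⁻¹ * g ∈ doubleCoset F n (sT n k * w) := by
  obtain ⟨b₁, hb₁, b₂, hb₂, rfl⟩ := hg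
  obtain ⟨d, b', hb', h0, rfl⟩ := decomp_right F h b₁ hb₁
  have e1 := n_mul_s F h
  have e1' := s_mul_n F h
  have e2 := conj_s F h b' hb' h0
  have e3 := conj_x F h w hw d
  have hs : permGL F n (sT n k) * permGL F n (sT n k) = 1 := by
    rw [← permGL_mul_mul, sT_mul h, permGL_one]
  set S := permGL F n (sT n k) with hS
  have hSi : S⁻¹ = S := inv_eq_of_mul_eq_one_left hs
  refine ⟨xGL F n k c * (S * nGL F n k)⁻¹ * (S * b' * S), ?_,
    ((permGL F n w)⁻¹ * xGL F n k d * permGL F n w) * b₂, ?_, ?_⟩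
  · exact mul_mem (mul_mem (xGL_mem F h c) (inv_mem e1')) e2
  · exact mul_mem e3 hb₂
  · rw [permGL_mul_mul, ← hS]
    have hs' : ∀ z, S * (S * z) = z := fun z => by rw [← mul_assoc, hs, one_mul]
    simp only [_root_.mul_inv_rev, mul_assoc, hSi, hs', mul_inv_cancel_left]

lemma cell_sub (h : Adj n k a b) (w : Equiv.Perm (Fin n))
    (g : GL (Fin n) F) (hg : g ∈ doubleCoset F n (sT n k * w)) :
    ∃ c : F, ∃ g' ∈ doubleCoset F n w, g = xGL F n k c * (nGL F n k)⁻¹ * g' := by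
  obtain ⟨b₁, hb₁, b₂, hb₂, rfl⟩ := hg
  obtain ⟨d, b', hb', h0, rfl⟩ := decomp_left F h b₁ hb₁
  have e1 := n_mul_s F h
  have e2 := conj_s F h b' hb' h0
  have hs : permGL F n (sT n k) * permGL F n (sT n k) = 1 := by
    rw [← permGL_mul_mul, sT_mul h, permGL_one]
  rw [permGL_mul_mul]
  set S := permGL F n (sT n k) with hS
  refine ⟨d, _, ⟨(nGL F n k * S) * (S * b' * S), mul_mem e1 e2, b₂, hb₂, rfl⟩, ?_⟩
  have hs' : ∀ z, S * (S * z) = z := fun z => by rw [← mul_assoc, hs, one_mul]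
  simp only [mul_assoc, hs', inv_mul_cancel_left]

lemma cell_inj (h : Adj n k a b) (w : Equiv.Perm (Fin n)) (hw : w⁻¹ a < w⁻¹ b) (c c' : F)
    (g g' β : GL (Fin n) F) (hg : g ∈ doubleCoset F n w) (hg' : g' ∈ doubleCoset F n w)
    (hβ : β ∈ Bsub F n)
    (he : xGL F n k c * (nGL F n k)⁻¹ * g = xGL F n k c' * (nGL F n k)⁻¹ * g' * β) : c = c' := by
  by_contra hne
  have hy : yGL F n k (-(c - c')) * g = g' * β := by
    have h1 : yGL F n k (-(c - c')) = nGL F n k * xGL F n k (c - c') * (nGL F n k)⁻¹ := by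
      rw [n_mul_x F h, mul_inv_cancel_right]
    have h2 : xGL F n k (c - c') = (xGL F n k c')⁻¹ * xGL F n k c := by
      rw [xGL_inv F h, xGL_mul F h]; congr 1; ring
    rw [h1, h2]
    have h3 : nGL F n k * ((xGL F n k c')⁻¹ * xGL F n k c) * (nGL F n k)⁻¹ * g =
      nGL F n k * (xGL F n k c')⁻¹ * (xGL F n k c * (nGL F n k)⁻¹ * g) := by
      simp only [mul_assoc]
    rw [h3, he]
    group
  obtain ⟨b₁, hb₁, b₂, hb₂, rfl⟩ := hg
  obtain ⟨b₃, hb₃, b₄, hb₄, rfl⟩ := hg'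
  have hp : b₃⁻¹ * (yGL F n k (-(c - c')) * b₁) * permGL F n w =
      permGL F n w * (b₄ * β * b₂⁻¹) := by
    have h4 : b₃⁻¹ * (yGL F n k (-(c - c')) * b₁) * permGL F n w =
      b₃⁻¹ * (yGL F n k (-(c - c')) * (b₁ * permGL F n w * b₂)) * b₂⁻¹ := by
      simp only [mul_assoc, mul_inv_cancel, mul_one]
    rw [h4, hy]
    group
  have hq : b₄ * β * b₂⁻¹ ∈ Bsub F n := mul_mem (mul_mem hb₄ hβ) (inv_mem hb₂)
  have hz : (permGL F n w * (b₄ * β * b₂⁻¹)).val (w (w⁻¹ b)) (w⁻¹ a) = 0 := by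
    rw [permGL_mul]
    exact (Bsub_mem F n _).1 hq _ _ hw
  have hi : b₃⁻¹ ∈ Bsub F n := inv_mem hb₃
  rw [← hp, mul_permGL, show w (w⁻¹ b) = b from Equiv.apply_symm_apply w b,
    show w (w⁻¹ a) = a from Equiv.apply_symm_apply w a, Units.val_mul,
    Matrix.mul_apply, Finset.sum_eq_single b] at hz
  · rw [Units.val_mul, yGL_val F h, transv_mul, if_pos rfl, (Bsub_mem F n _).1 hb₁ _ _ h.lt,
      zero_add] at hz
    exact mul_ne_zero (Bsub_diag F n _ hi b) (mul_ne_zero (neg_ne_zero.2 (sub_ne_zero.2 hne))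
      (Bsub_diag F n _ hb₁ a)) hz
  · intro i _ hib
    rcases lt_or_gt_of_ne hib with hlt | hlt
    · rw [(Bsub_mem F n _).1 hi _ _ hlt, zero_mul]
    · rw [Units.val_mul, yGL_val F h, transv_mul, if_neg hib,
        (Bsub_mem F n _).1 hb₁ _ _ (h.lt.trans hlt), zero_add, mul_zero]
  · simp

lemma exchange (l : List ℕ) : ∀ (hv : ∀ k ∈ l, 0 < k ∧ k < n) (p q : Fin n) (hpq : p < q)
    (hw : (l.map (sT n)).prod⁻¹ q < (l.map (sT n)).prod⁻¹ p),
    ∃ l' : List ℕ, (∀ k ∈ l', 0 < k ∧ k < n) ∧ l'.length + 1 = l.length ∧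
      (l'.map (sT n)).prod = Equiv.swap p q * (l.map (sT n)).prod := by
  induction l with
  | nil =>
    intro _ p q hpq hw
    simp at hw
    exact absurd hpq hw.not_gt
  | cons j l ih =>
    intro hv p q hpq hw
    obtain ⟨a, b, h⟩ := Adj.exists n (hv j (by simp))
    have hv' : ∀ k ∈ l, 0 < k ∧ k < n := fun k hk => hv k (by simp [hk])
    rw [List.map_cons, List.prod_cons, _root_.mul_inv_rev, sT_inv h, sT_eq h,
      Equiv.Perm.mul_apply, Equiv.Perm.mul_apply] at hw
    by_cases hc : q = b ∧ p = a
    · refine ⟨l, hv', rfl, ?_⟩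
      rw [List.map_cons, List.prod_cons, sT_eq h, hc.1, hc.2, ← mul_assoc,
        Equiv.swap_mul_self, one_mul]
    · obtain ⟨l', h1, h2, h3⟩ := ih hv' _ _ (swap_lt h hpq hc) hw
      refine ⟨j :: l', ?_, by simp [h2], ?_⟩
      · intro k hk
        rcases List.mem_cons.1 hk with rfl | hk
        · exact h.hk
        · exact h1 k hk
      · rw [List.map_cons, List.prod_cons, List.map_cons, List.prod_cons, h3, sT_eq h,
          ← mul_assoc, ← mul_assoc, Equiv.swap_apply_apply, Equiv.swap_inv, ← mul_assoc,
          ← mul_assoc, Equiv.swap_mul_self, one_mul]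

lemma reduced_tail {l : List ℕ} {w : Equiv.Perm (Fin n)} (h : Adj n k a b)
    (hl : IsReducedWord n (k :: l) w) :
    IsReducedWord n l (sT n k * w) ∧ w = sT n k * (sT n k * w) ∧
      (sT n k * w)⁻¹ a < (sT n k * w)⁻¹ b := by
  obtain ⟨h1, h2, h3⟩ := hl
  rw [List.map_cons, List.prod_cons] at h2
  have hss : ∀ u, sT n k * (sT n k * u) = u := fun u => by rw [← mul_assoc, sT_mul h, one_mul]
  have hp : (l.map (sT n)).prod = sT n k * w := by rw [← h2, hss]
  have hv' : ∀ k ∈ l, 0 < k ∧ k < n := fun k hk => h1 k (by simp [hk])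
  refine ⟨⟨hv', hp, ?_⟩, (hss w).symm, ?_⟩
  · intro l' hv hl'
    have := h3 (k :: l') (by
      intro j hk
      rcases List.mem_cons.1 hk with rfl | hk
      · exact h.hk
      · exact hv j hk) (by rw [List.map_cons, List.prod_cons, hl', hss])
    simpa using this
  · by_contra hlt
    have hne : (sT n k * w)⁻¹ b ≠ (sT n k * w)⁻¹ a := fun e =>
      h.lt.ne' ((Equiv.injective _) e)
    have hlt' := lt_of_le_of_ne (not_lt.1 hlt) hne
    rw [← hp] at hlt'
    obtain ⟨l', g1, g2, g3⟩ := exchange l hv' a b h.lt hlt'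
    have := h3 l' g1 (by rw [g3, ← sT_eq h, h2])
    simp at this
    omega

lemma prodWord_cons (k : ℕ) (l : List ℕ) (c : Fin (k :: l).length → F) :
    prodWord F n (k :: l) c = xGL F n k (c 0) * (nGL F n k)⁻¹ *
      prodWord F n l (fun i => c i.succ) := by
  simp only [prodWord]
  rw [← List.prod_cons]
  exact congrArg List.prod (List.ofFn_succ (n := l.length) (f := fun m : Fin (l.length + 1) =>
    xGL F n ((k :: l).get m) (c m) * (nGL F n ((k :: l).get m))⁻¹))

lemma main_aux (l : List ℕ) : ∀ w : Equiv.Perm (Fin n), IsReducedWord n l w →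
    (∀ c, prodWord F n l c ∈ doubleCoset F n w) ∧
    (∀ g ∈ doubleCoset F n w, ∃ c, (prodWord F n l c)⁻¹ * g ∈ Bsub F n) ∧
    (∀ c c', (prodWord F n l c)⁻¹ * prodWord F n l c' ∈ Bsub F n → c = c') := by
  induction l with
  | nil =>
    intro w hw
    have hw1 : w = 1 := by simpa using hw.2.1.symm
    subst hw1
    refine ⟨fun c => ⟨1, one_mem _, 1, one_mem _, by simp [prodWord, permGL_one]⟩, ?_, ?_⟩
    · rintro g ⟨b₁, hb₁, b₂, hb₂, rfl⟩
      refine ⟨fun i => 0, ?_⟩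
      simpa [prodWord, permGL_one] using mul_mem hb₁ hb₂
    · intro c c' _
      funext i
      exact i.elim0
  | cons k l ih =>
    intro w hw
    obtain ⟨a, b, h⟩ := Adj.exists n (hw.1 k (by simp))
    obtain ⟨hr, hw', hlt⟩ := reduced_tail h hw
    obtain ⟨i1, i2, i3⟩ := ih _ hr
    refine ⟨?_, ?_, ?_⟩
    · intro c
      rw [prodWord_cons, hw']
      exact cell_sup F h _ hlt _ _ (i1 _)
    · intro g hg
      rw [hw'] at hg
      obtain ⟨d, g', hg', rfl⟩ := cell_sub F h _ g hg
      obtain ⟨c, hc⟩ := i2 g' hg'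
      refine ⟨Fin.cons d c, ?_⟩
      rw [prodWord_cons]
      simp only [Fin.cons_zero, Fin.cons_succ]
      convert hc using 1
      group
    · intro c c' hcc
      rw [prodWord_cons, prodWord_cons] at hcc
      have h0 : c 0 = c' 0 := by
        refine (cell_inj F h _ hlt _ _ _ _ _ (i1 fun i => c' i.succ)
          (i1 fun i => c i.succ) hcc ?_).symm
        simp only [mul_inv_cancel_left]
      rw [h0] at hcc
      have := i3 (fun i => c i.succ) (fun i => c' i.succ) (by
        convert hcc using 1
        group)
      funext i
      refine Fin.cases h0 (fun i => congrFun this i) i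

/-- **Parametrization of Schubert cells in `GL_n`.**
If `l` is a reduced word for `w ∈ S_n`, then the map `F^ℓ → G/B`,
`(c₁, …, c_ℓ) ↦ x_{i₁}(c₁) n_{i₁}⁻¹ ⋯ x_{i_ℓ}(c_ℓ) n_{i_ℓ}⁻¹ B`, is injective with image
exactly the set of cosets `{gB : g ∈ BwB}`. -/
theorem schubert_cell_parametrization (F : Type*) [Field F] (n : ℕ) (hn : 2 ≤ n)
    (w : Equiv.Perm (Fin n)) (l : List ℕ) (hl : IsReducedWord n l w) :
    Function.Injective (fun c : Fin l.length → F =>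
      (QuotientGroup.mk (prodWord F n l c) : GL (Fin n) F ⧸ Bsub F n)) ∧
    Set.range (fun c : Fin l.length → F =>
        (QuotientGroup.mk (prodWord F n l c) : GL (Fin n) F ⧸ Bsub F n)) =
      {x : GL (Fin n) F ⧸ Bsub F n | ∃ g ∈ doubleCoset F n w, QuotientGroup.mk g = x} := by
  obtain ⟨h1, h2, h3⟩ := main_aux F l w hl
  refine ⟨fun c c' hcc => h3 c c' (QuotientGroup.eq.1 hcc), ?_⟩
  ext x
  constructor
  · rintro ⟨c, rfl⟩
    exact ⟨_, h1 c, rfl⟩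
  · rintro ⟨g, hg, rfl⟩
    obtain ⟨c, hc⟩ := h2 g hg
    exact ⟨c, QuotientGroup.eq.2 hc⟩
end

section
/- Main Theorem for GL_n over a finite field: fix 1 ≤ i, j ≤ n−1 with i ≠ j and w ∈ S_n, and write w = u z v with u ∈ W^j, z ∈ (W_j)^{i,j}, v ∈ W_{i,j} (this factorization exists and is unique). Then for every line hP_j of the Schubert incidence structure (X_w)_{ij} (i.e., h ∈ BwB), the number of points gP_i of (X_w)_{ij} incident to hP_j equals q^{ℓ(z)}. -/
open Matrix

variable (F : Type*) [Field F] (n : ℕ)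

section helpers

theorem helper_wfix {n j : ℕ} {z : Equiv.Perm (Fin n)} (hz : z ∈ Wfix n j) (a : Fin n) :
    ((z a : Fin n) : ℕ) < j ↔ (a : ℕ) < j := by
  have hz' : (fun a => z a) '' {a : Fin n | (a : ℕ) < j} = {a : Fin n | (a : ℕ) < j} := hz
  constructor
  · intro h
    have : z a ∈ (fun a => z a) '' {a : Fin n | (a : ℕ) < j} := by rw [hz']; exact h
    obtain ⟨a', h1, h2⟩ := this
    have := z.injective h2
    subst this; exact h1
  · intro h
    have : z a ∈ {a : Fin n | (a : ℕ) < j} := by rw [← hz']; exact ⟨a, h, rfl⟩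
    exact this

theorem helper_swap_mem {n j k : ℕ} (hk : k + 1 < n) (h : k < j ↔ k + 1 < j) :
    Equiv.swap (⟨k, by omega⟩ : Fin n) ⟨k + 1, hk⟩ ∈ Wfix n j := by
  have key : ∀ a : Fin n, (a : ℕ) < j →
      ((Equiv.swap (⟨k, by omega⟩ : Fin n) ⟨k + 1, hk⟩ a : Fin n) : ℕ) < j := by
    intro a ha
    rw [Equiv.swap_apply_def]
    split_ifs with h1 h2
    · subst h1; simp at *; omega
    · subst h2; simp at *; omega
    · exact ha
  show _ '' _ = _
  ext a
  constructor
  · rintro ⟨b, hb, rfl⟩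
    exact key b hb
  · intro ha
    exact ⟨_, key a ha, Equiv.swap_apply_self _ _ _⟩

theorem helper_inv_lt {n k : ℕ} (hk : k + 1 < n) (w : Equiv.Perm (Fin n))
    (h : w ⟨k + 1, hk⟩ < w ⟨k, by omega⟩) :
    invCount n (w * Equiv.swap (⟨k, by omega⟩ : Fin n) ⟨k + 1, hk⟩) < invCount n w := by
  unfold invCount
  set s := Equiv.swap (⟨k, by omega⟩ : Fin n) ⟨k + 1, hk⟩ with hs
  rw [← Finset.card_map (Equiv.prodCongr s s).toEmbedding]
  apply Finset.card_lt_card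
  rw [Finset.ssubset_iff_of_subset]
  · refine ⟨(⟨k, by omega⟩, ⟨k + 1, hk⟩), ?_, ?_⟩
    · simp [h]
    · rw [Finset.mem_map]
      rintro ⟨⟨a, b⟩, hab, he⟩
      replace hab := (Finset.mem_filter.mp hab).2
      simp only [Equiv.Perm.mul_apply] at hab
      simp only [Equiv.coe_toEmbedding, Equiv.prodCongr_apply, Prod.map_apply,
        Prod.mk.injEq] at he
      have ha : a = ⟨k + 1, hk⟩ := by
        rw [← Equiv.swap_apply_left (⟨k, by omega⟩ : Fin n) ⟨k + 1, hk⟩, ← hs, ← he.1, hs,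
          Equiv.swap_apply_self]
      have hb : b = ⟨k, by omega⟩ := by
        rw [← Equiv.swap_apply_right (⟨k, by omega⟩ : Fin n) ⟨k + 1, hk⟩, ← hs, ← he.2, hs,
          Equiv.swap_apply_self]
      have h1 := hab.1
      rw [ha, hb, Fin.lt_def] at h1
      simp at h1
  · intro x hx
    rw [Finset.mem_map] at hx
    obtain ⟨⟨a, b⟩, hab, rfl⟩ := hx
    replace hab := (Finset.mem_filter.mp hab).2
    simp only [Equiv.Perm.mul_apply] at hab
    simp only [Equiv.coe_toEmbedding, Equiv.prodCongr_apply, Prod.map_apply,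
      Finset.mem_filter, Finset.mem_univ, true_and]
    refine ⟨?_, hab.2⟩
    obtain ⟨h1, h2⟩ := hab
    by_cases hc : a = ⟨k, by omega⟩ ∧ b = ⟨k + 1, hk⟩
    · rw [hc.1, hc.2, hs, Equiv.swap_apply_left, Equiv.swap_apply_right] at h2
      exact absurd h2 (lt_asymm h)
    · clear h2
      rw [hs, Equiv.swap_apply_def, Equiv.swap_apply_def]
      simp only [Fin.ext_iff, Fin.lt_def] at *
      split_ifs <;> simp at * <;> omega

theorem helper_mono {n : ℕ} (w : Equiv.Perm (Fin n)) (c : ℕ → ℕ) (hc : Monotone c)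
    (h : ∀ k (hk : k + 1 < n), c k = c (k + 1) → w ⟨k, by omega⟩ < w ⟨k + 1, hk⟩) :
    ∀ a b : Fin n, a < b → c a = c b → w a < w b := by
  have : ∀ d a (hd : a + d + 1 < n), c a = c (a + d + 1) →
      w ⟨a, by omega⟩ < w ⟨a + d + 1, hd⟩ := by
    intro d
    induction d with
    | zero => intro a hd hh; exact h a hd hh
    | succ d ih =>
      intro a hd hh
      have h1 : c a ≤ c (a + d + 1) := hc (by omega)
      have h2 : c (a + d + 1) ≤ c (a + (d + 1) + 1) := hc (by omega)
      exact (ih a (by omega) (by omega)).trans (h (a + d + 1) hd (by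
        show c (a + d + 1) = c (a + (d + 1) + 1)
        omega))
  rintro ⟨a, ha⟩ ⟨b, hb⟩ hab hh
  have hab' : a < b := hab
  obtain ⟨d, rfl⟩ := Nat.exists_eq_add_of_lt hab'
  exact this d a hb hh

theorem helper_u {n j : ℕ} {u : Equiv.Perm (Fin n)} (hu : u ∈ minReps n j) (a b : Fin n)
    (hab : a < b) (h : (a : ℕ) < j ↔ (b : ℕ) < j) : u a < u b := by
  refine helper_mono u (fun x => if x < j then 0 else 1) ?_ ?_ a b hab ?_
  · intro x y hxy
    dsimp only
    split_ifs <;> omega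
  · intro k hk hh
    by_contra hlt
    have hne : u ⟨k, by omega⟩ ≠ u ⟨k + 1, hk⟩ := fun he => by
      have := u.injective he
      simp at this
    have h1 := helper_inv_lt hk u (lt_of_le_of_ne (not_lt.mp hlt) hne.symm)
    have h2 := hu _ (helper_swap_mem (j := j) hk (by
      split_ifs at hh <;> omega))
    omega
  · simp [h]

theorem helper_z {n i j : ℕ} {z : Equiv.Perm (Fin n)} (hz : z ∈ minRepsIn n i j) (a b : Fin n)
    (hab : a < b) (h : (a : ℕ) < j ↔ (b : ℕ) < j) (h' : (a : ℕ) < i ↔ (b : ℕ) < i) :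
    z a < z b := by
  refine helper_mono z (fun x => (if x < j then 0 else 1) + (if x < i then 0 else 1))
    ?_ ?_ a b hab ?_
  · intro x y hxy
    dsimp only
    split_ifs <;> omega
  · intro k hk hh
    by_contra hlt
    have hne : z ⟨k, by omega⟩ ≠ z ⟨k + 1, hk⟩ := fun he => by
      have := z.injective he
      simp at this
    have h1 := helper_inv_lt hk z (lt_of_le_of_ne (not_lt.mp hlt) hne.symm)
    have h2 := hz.2 _ ⟨helper_swap_mem (j := i) hk (by
      split_ifs at hh <;> omega), helper_swap_mem (j := j) hk (by
      split_ifs at hh <;> omega)⟩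
    omega
  · simp [h, h']

/-- the relevant pairs -/
def NN (n i j : ℕ) (w : Equiv.Perm (Fin n)) : Finset (Fin n × Fin n) :=
  Finset.univ.filter fun p => (p.1 : ℕ) < i ∧ i ≤ (p.2 : ℕ) ∧
    ((p.1 : ℕ) < j ↔ (p.2 : ℕ) < j) ∧ w p.2 < w p.1

theorem helper_card {n i j : ℕ} {w u z v : Equiv.Perm (Fin n)}
    (hu : u ∈ minReps n j) (hz : z ∈ minRepsIn n i j) (hv : v ∈ Wfix n i ∩ Wfix n j)
    (hw : w = u * z * v) : (NN n i j w).card = invCount n z := by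
  unfold NN invCount
  refine Finset.card_equiv (Equiv.prodCongr v v) ?_
  rintro ⟨b, a⟩
  simp only [Finset.mem_filter, Finset.mem_univ, true_and, Equiv.prodCongr_apply,
    Prod.map_apply, hw, Equiv.Perm.mul_apply]
  have e1 := helper_wfix hv.1 a
  have e2 := helper_wfix hv.1 b
  have e3 := helper_wfix hv.2 a
  have e4 := helper_wfix hv.2 b
  have e5 := helper_wfix hz.1 (v a)
  have e6 := helper_wfix hz.1 (v b)
  generalize v a = x at *
  generalize v b = y at *
  constructor
  · rintro ⟨h1, h2, h3, h4⟩
    refine ⟨?_, ?_⟩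
    · rw [Fin.lt_def]; omega
    · by_contra hlt
      rcases (not_lt.mp hlt).lt_or_eq with h | h
      · exact lt_asymm h4 (helper_u hu _ _ h (by omega))
      · rw [h] at h4; exact lt_irrefl _ h4
  · rintro ⟨h1, h2⟩
    have hj : (y : ℕ) < j ↔ (x : ℕ) < j := by
      rw [Fin.lt_def] at h1 h2
      omega
    have hi : ¬ ((y : ℕ) < i ↔ (x : ℕ) < i) := fun hi =>
      lt_asymm h2 (helper_z hz _ _ h1 hj hi)
    have h4 := helper_u hu _ _ h2 (by omega)
    rw [Fin.lt_def] at h1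
    refine ⟨by omega, by omega, by omega, h4⟩

theorem helper_permMatrix {K : Type*} [Field K] {n : ℕ} (w : Equiv.Perm (Fin n))
    (g : GL (Fin n) K) (x y : Fin n) :
    ((permGL K n w * g * (permGL K n w)⁻¹ : GL (Fin n) K) : Matrix (Fin n) (Fin n) K) x y
      = (g : Matrix (Fin n) (Fin n) K) (w⁻¹ x) (w⁻¹ y) := by
  show ((((w⁻¹).permMatrix K) * (g : Matrix (Fin n) (Fin n) K)) * (w.permMatrix K)) x y = _
  rw [Equiv.Perm.permMatrix, Equiv.Perm.permMatrix, PEquiv.toMatrix_toPEquiv_mul,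
    PEquiv.mul_toMatrix_toPEquiv]
  rfl

/-- conjugated group -/
def Qsub (K : Type*) [Field K] (n j : ℕ) (w : Equiv.Perm (Fin n)) : Subgroup (GL (Fin n) K) :=
  (Bsub K n).comap (MulAut.conj (permGL K n w)).toMonoidHom ⊓ Pmax K n j

theorem mem_Qsub' {K : Type*} [Field K] {n j : ℕ} {w : Equiv.Perm (Fin n)} {g : GL (Fin n) K} :
    g ∈ Qsub K n j w ↔ permGL K n w * g * (permGL K n w)⁻¹ ∈ Bsub K n ∧ g ∈ Pmax K n j :=
  Iff.rfl

theorem mem_Pmax {K : Type*} [Field K] {n j : ℕ} {g : GL (Fin n) K} :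
    g ∈ Pmax K n j ↔ ∀ a b : Fin n, (b : ℕ) < j → j ≤ (a : ℕ) →
      (g : Matrix (Fin n) (Fin n) K) a b = 0 := by
  constructor
  · intro h a b hb ha
    refine h ?_
    simp [hb, not_lt.mpr ha]
  · intro h a b hab
    dsimp only at hab
    refine h a b ?_ ?_ <;> split_ifs at hab <;> omega

theorem mem_Qsub {K : Type*} [Field K] {n j : ℕ} {w : Equiv.Perm (Fin n)} {g : GL (Fin n) K} :
    g ∈ Qsub K n j w ↔ (∀ a b : Fin n, w b < w a → (g : Matrix (Fin n) (Fin n) K) a b = 0) ∧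
      (∀ a b : Fin n, (b : ℕ) < j → j ≤ (a : ℕ) →
        (g : Matrix (Fin n) (Fin n) K) a b = 0) := by
  rw [mem_Qsub', mem_Pmax]
  refine and_congr_left fun _ => ?_
  constructor
  · intro h a b hab
    have := h (i := w a) (j := w b) hab
    rw [helper_permMatrix] at this
    simpa using this
  · intro h a b hab
    rw [helper_permMatrix]
    apply h
    simpa using hab

/-- strictly lower part -/
def EE {K : Type*} [Field K] {n i j : ℕ} {w : Equiv.Perm (Fin n)} (f : NN n i j w → K) :
    Matrix (Fin n) (Fin n) K :=
  fun a b => if h : (b, a) ∈ NN n i j w then f ⟨(b, a), h⟩ else 0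

theorem mem_NN {n i j : ℕ} {w : Equiv.Perm (Fin n)} {a b : Fin n} :
    (b, a) ∈ NN n i j w ↔ ((b : ℕ) < i ∧ i ≤ (a : ℕ) ∧
    ((b : ℕ) < j ↔ (a : ℕ) < j) ∧ w a < w b) := by simp [NN]

theorem EE_ne {K : Type*} [Field K] {n i j : ℕ} {w : Equiv.Perm (Fin n)} (f : NN n i j w → K)
    {a b : Fin n} (h : EE f a b ≠ 0) : (b, a) ∈ NN n i j w := by
  by_contra hc
  exact h (by simp [EE, hc])

theorem EE_mul {K : Type*} [Field K] {n i j : ℕ} {w : Equiv.Perm (Fin n)}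
    (f f' : NN n i j w → K) : EE f * EE f' = 0 := by
  ext a b
  rw [Matrix.mul_apply]
  refine Finset.sum_eq_zero fun x _ => ?_
  by_contra hc
  have h1 := mem_NN.mp (EE_ne f (left_ne_zero_of_mul hc))
  have h2 := mem_NN.mp (EE_ne f' (right_ne_zero_of_mul hc))
  omega

/-- unipotent element -/
def eG {K : Type*} [Field K] {n i j : ℕ} {w : Equiv.Perm (Fin n)} (f : NN n i j w → K) :
    GL (Fin n) K where
  val := 1 + EE f
  inv := 1 - EE f
  val_inv := by
    have := EE_mul f f
    noncomm_ring
    simp [this]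
  inv_val := by
    have := EE_mul f f
    noncomm_ring
    simp [this]

theorem eG_mem {K : Type*} [Field K] {n i j : ℕ} {w : Equiv.Perm (Fin n)} (f : NN n i j w → K) :
    eG f ∈ Qsub K n j w := by
  rw [mem_Qsub]
  constructor
  · intro a b hab
    show (1 + EE f) a b = 0
    have hne : a ≠ b := by rintro rfl; exact lt_irrefl _ hab
    rw [Matrix.add_apply, Matrix.one_apply_ne hne, zero_add]
    by_contra hc
    have := mem_NN.mp (EE_ne f hc)
    exact lt_asymm hab this.2.2.2
  · intro a b hb ha
    show (1 + EE f) a b = 0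
    have hne : a ≠ b := by rintro rfl; omega
    rw [Matrix.add_apply, Matrix.one_apply_ne hne, zero_add]
    by_contra hc
    have := mem_NN.mp (EE_ne f hc)
    omega

theorem eG_inj {K : Type*} [Field K] {n i j : ℕ} {w : Equiv.Perm (Fin n)}
    (f f' : NN n i j w → K) (h : (eG f)⁻¹ * eG f' ∈ Pmax K n i) : f = f' := by
  funext ⟨⟨b, a⟩, hp⟩
  have hm := mem_NN.mp hp
  have h1 := mem_Pmax.mp h a b hm.1 hm.2.1
  have hne : a ≠ b := by rintro rfl; omega
  change ((1 - EE f) * (1 + EE f')) a b = 0 at h1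
  have h2 : (1 - EE f) * (1 + EE f') = 1 + EE f' - EE f := by
    rw [sub_mul, mul_add, mul_add, EE_mul, one_mul, one_mul, mul_one, add_zero]
  rw [h2, Matrix.sub_apply, Matrix.add_apply, Matrix.one_apply_ne hne, zero_add] at h1
  simp only [EE, hp, dif_pos] at h1
  exact (sub_eq_zero.mp h1).symm

theorem diag_ne {K : Type*} [Field K] {n j : ℕ} {w : Equiv.Perm (Fin n)} {g : GL (Fin n) K}
    (hg : g ∈ Qsub K n j w) (a : Fin n) : (g : Matrix (Fin n) (Fin n) K) a a ≠ 0 := by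
  intro h0
  have h1 := (mem_Qsub.mp hg).1
  have h2 := (mem_Qsub.mp (inv_mem hg)).1
  have h3 : ((g * g⁻¹ : GL (Fin n) K) : Matrix (Fin n) (Fin n) K) a a = 1 := by simp
  rw [Units.val_mul, Matrix.mul_apply] at h3
  rw [Finset.sum_eq_zero] at h3
  · exact zero_ne_one h3
  · intro x _
    rcases lt_trichotomy (w a) (w x) with h | h | h
    · rw [h2 x a h, mul_zero]
    · have := w.injective h
      subst this
      rw [h0, zero_mul]
    · rw [h1 a x h, zero_mul]

theorem helper_exists {K : Type*} [Field K] {n j : ℕ} {w : Equiv.Perm (Fin n)}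
    (A : Matrix (Fin n) (Fin n) K) (h1 : ∀ a b : Fin n, w b < w a → A a b = 0)
    (hd : ∀ a, A a a ≠ 0)
    (h2 : ∀ a b : Fin n, (b : ℕ) < j → j ≤ (a : ℕ) → A a b = 0) :
    ∃ g ∈ Qsub K n j w, (g : Matrix (Fin n) (Fin n) K) = A := by
  have hdet : A.det ≠ 0 := by
    rw [← Matrix.det_submatrix_equiv_self w⁻¹ A, Matrix.det_of_upperTriangular]
    · exact Finset.prod_ne_zero_iff.mpr fun a _ => hd _
    · intro a b hab
      apply h1
      simpa using hab
  refine ⟨Matrix.GeneralLinearGroup.mkOfDetNeZero A hdet, ?_, rfl⟩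
  rw [mem_Qsub]
  exact ⟨h1, h2⟩

theorem eG_surj {K : Type*} [Field K] {n i j : ℕ} {w : Equiv.Perm (Fin n)} {g : GL (Fin n) K}
    (hg : g ∈ Qsub K n j w) : ∃ f : NN n i j w → K, (eG f)⁻¹ * g ∈ Pmax K n i := by
  have hg' := mem_Qsub.mp hg
  obtain ⟨A, hA, hAe⟩ := helper_exists (K := K) (j := j) (w := w)
    (fun a b => if (a : ℕ) < i ∧ (b : ℕ) < i then (g : Matrix (Fin n) (Fin n) K) a b else
      if a = b then 1 else 0)
    (by
      intro a b hab
      have hne : a ≠ b := by rintro rfl; exact lt_irrefl _ hab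
      simp [hg'.1 a b hab, hne])
    (by
      intro a
      split_ifs
      · exact diag_ne hg a
      · exact one_ne_zero
      · exact absurd rfl ‹¬ a = a›)
    (by
      intro a b hb ha
      have hne : a ≠ b := by rintro rfl; omega
      simp [hg'.2 a b hb ha, hne])
  have hD := mem_Qsub.mp (mul_mem hg (inv_mem hA))
  have hgD : g = (g * A⁻¹) * A := by simp
  generalize g * A⁻¹ = D at hD hgD
  refine ⟨fun p => (D : Matrix (Fin n) (Fin n) K) p.1.2 p.1.1, ?_⟩
  rw [mem_Pmax]
  intro a b hb ha
  set f : NN n i j w → K := fun p => (D : Matrix (Fin n) (Fin n) K) p.1.2 p.1.1 with hf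
  change ((1 - EE f) * (g : Matrix (Fin n) (Fin n) K)) a b = 0
  rw [sub_mul, one_mul, Matrix.sub_apply, sub_eq_zero]
  conv_lhs => rw [hgD]
  rw [Units.val_mul, Matrix.mul_apply, Matrix.mul_apply]
  refine Finset.sum_congr rfl fun x _ => ?_
  rw [hAe]
  dsimp only
  by_cases hx : (x : ℕ) < i
  · rw [if_pos ⟨hx, hb⟩]
    congr 1
    unfold EE
    split_ifs with h
    · rfl
    · rw [mem_NN] at h
      by_cases hlt : w x < w a
      · exact hD.1 a x hlt
      · refine hD.2 a x ?_ ?_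
        all_goals
          have hne : w x ≠ w a := fun he => by
            have := w.injective he
            subst this; omega
          have h4 : w a < w x := lt_of_le_of_ne (not_lt.mp hlt) hne.symm
          by_contra hc
          refine h ⟨hx, ha, ?_, h4⟩
          omega
  · have hne : x ≠ b := by rintro rfl; omega
    have hE : EE f a x = 0 := by
      by_contra hc
      exact hx (mem_NN.mp (EE_ne f hc)).1
    simp [hx, hne, hE]

theorem Bsub_le_Pmax {K : Type*} [Field K] {n j : ℕ} {g : GL (Fin n) K} (hg : g ∈ Bsub K n) :
    g ∈ Pmax K n j := by
  rw [mem_Pmax]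
  intro a b hb ha
  refine hg ?_
  show b < a
  rw [Fin.lt_def]; omega

end helpers

/-- **Main Theorem for `GL_n` over a finite field:** write `w = u z v` with `u ∈ W^j`,
`z ∈ (W_j)^{i,j}`, `v ∈ W_{i,j}`.  For every line `hP_j` of the Schubert incidence structure
`(X_w)_{ij}` (i.e. `h ∈ BwB`), the number of points `gP_i` of `(X_w)_{ij}` incident to `hP_j`
is `q^{ℓ(z)}`. -/
theorem schubert_incidence_count (q : ℕ) (hq : IsPrimePow q)
    (F : Type*) [Field F] [Fintype F] (hF : Fintype.card F = q)
    (n : ℕ) (hn : 2 ≤ n)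
    (i j : ℕ) (hi1 : 1 ≤ i) (hi2 : i ≤ n - 1) (hj1 : 1 ≤ j) (hj2 : j ≤ n - 1) (hij : i ≠ j)
    (w u z v : Equiv.Perm (Fin n))
    (hu : u ∈ minReps n j) (hz : z ∈ minRepsIn n i j) (hv : v ∈ Wfix n i ∩ Wfix n j)
    (hw : w = u * z * v)
    (h : GL (Fin n) F) (hh : h ∈ doubleCoset F n w) :
    Set.ncard {x : GL (Fin n) F ⧸ Pmax F n i | ∃ k ∈ doubleCoset F n w,
        QuotientGroup.mk k = x ∧
          (QuotientGroup.mk k : GL (Fin n) F ⧸ Pmax F n j) = QuotientGroup.mk h} =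
      q ^ invCount n z := by
  obtain ⟨b₁, hb₁, b₂, hb₂, rfl⟩ := hh
  have hset : {x : GL (Fin n) F ⧸ Pmax F n i | ∃ k ∈ doubleCoset F n w,
        QuotientGroup.mk k = x ∧
          (QuotientGroup.mk k : GL (Fin n) F ⧸ Pmax F n j) =
            QuotientGroup.mk (b₁ * permGL F n w * b₂)} =
      Set.range (fun f : NN n i j w → F =>
        (QuotientGroup.mk (b₁ * permGL F n w * eG f) : GL (Fin n) F ⧸ Pmax F n i)) := by
    ext x
    constructor
    · rintro ⟨k, ⟨c₁, hc₁, c₂, hc₂, rfl⟩, rfl, hk⟩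
      have hk' := QuotientGroup.eq.mp hk.symm
      have hg : (permGL F n w)⁻¹ * (b₁⁻¹ * c₁) * permGL F n w ∈ Qsub F n j w := by
        rw [mem_Qsub']
        constructor
        · have : permGL F n w * ((permGL F n w)⁻¹ * (b₁⁻¹ * c₁) * permGL F n w) *
              (permGL F n w)⁻¹ = b₁⁻¹ * c₁ := by group
          rw [this]
          exact mul_mem (inv_mem hb₁) hc₁
        · have : (permGL F n w)⁻¹ * (b₁⁻¹ * c₁) * permGL F n w =
              b₂ * ((b₁ * permGL F n w * b₂)⁻¹ * (c₁ * permGL F n w * c₂)) * c₂⁻¹ := by group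
          rw [this]
          exact mul_mem (mul_mem (Bsub_le_Pmax hb₂) hk') (inv_mem (Bsub_le_Pmax hc₂))
      obtain ⟨f, hf⟩ := eG_surj (i := i) hg
      refine ⟨f, ?_⟩
      refine QuotientGroup.eq.mpr ?_
      have : (b₁ * permGL F n w * eG f)⁻¹ * (c₁ * permGL F n w * c₂) =
          ((eG f)⁻¹ * ((permGL F n w)⁻¹ * (b₁⁻¹ * c₁) * permGL F n w)) * c₂ := by group
      rw [this]
      exact mul_mem hf (Bsub_le_Pmax hc₂)
    · rintro ⟨f, rfl⟩
      have hm := mem_Qsub'.mp (eG_mem f)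
      refine ⟨b₁ * permGL F n w * eG f, ⟨b₁ * (permGL F n w * eG f * (permGL F n w)⁻¹),
        mul_mem hb₁ hm.1, 1, one_mem _, by group⟩, rfl, ?_⟩
      refine QuotientGroup.eq.mpr ?_
      have : (b₁ * permGL F n w * eG f)⁻¹ * (b₁ * permGL F n w * b₂) = (eG f)⁻¹ * b₂ := by group
      rw [this]
      exact mul_mem (inv_mem hm.2) (Bsub_le_Pmax hb₂)
  rw [hset, ← Set.image_univ, Set.ncard_image_of_injective, Set.ncard_univ, Nat.card_fun,
    Nat.card_eq_fintype_card, Nat.card_eq_fintype_card, Fintype.card_coe, hF,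
    helper_card hu hz hv hw]
  intro f f' hff
  have h1 := QuotientGroup.eq.mp hff
  apply eG_inj
  have : (b₁ * permGL F n w * eG f)⁻¹ * (b₁ * permGL F n w * eG f') = (eG f)⁻¹ * eG f' := by
    group
  rwa [this] at h1
end
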